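/- arXiv:2005.05120 — 9 statements merged into one kernel-verified Lean document; each statement's English description precedes it below -/
import Mathlib

section
/- Let S be a surface of revolution with nonvanishing Gauss curvature whose position vector satisfies Δ^II x = A x for some real 3×3 matrix A, where Δ^II is the Laplace operator of the second fundamental form. Then either the mean curvature H vanishes identically on (a,b) (so S is a catenoid) or p² + q² is constant on (a,b) (so S is part of a sphere). Precisely: if A = (a_ij) is a real 3×3 matrix and for all u ∈ (a,b) and v ∈ ℝ each coordinate x_i of x(u,v) satisfies Δ^II x_i (u,v) = Σ_j a_ij x_j(u,v), then H ≡ 0 on (a,b) or p² + q² is constant on (a,b). -/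
open Real Set

/-- The Laplace (Beltrami) operator of the second fundamental form of the surface of
revolution `x(u,v) = (p(u)cos v, p(u)sin v, q(u))` (with `p' = cos φ`, `q' = sin φ`),
acting on a function `f(u,v)`:
`Δ^II f = −(1/φ') f_uu − (1/(p sin φ)) f_vv
  + (1/2)(φ''/φ'² − (cos φ sin φ + p φ' cos φ)/(p φ' sin φ)) f_u`. -/
noncomputable def DeltaII (p φ : ℝ → ℝ) (f : ℝ → ℝ → ℝ) (u v : ℝ) : ℝ :=
  -(1 / deriv φ u) * deriv (fun s => deriv (fun t => f t v) s) u
    - (1 / (p u * Real.sin (φ u))) * deriv (deriv (f u)) v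
    + (1 / 2) * (deriv (deriv φ) u / (deriv φ u) ^ 2
        - (Real.cos (φ u) * Real.sin (φ u) + p u * deriv φ u * Real.cos (φ u))
            / (p u * deriv φ u * Real.sin (φ u))) * deriv (fun t => f t v) u

open Filter Topology

/-- The derivative at `x` of a function vanishing near `x` is zero. -/
theorem HasDerivAt.eq_zero_of_eqOn_isOpen {F : ℝ → ℝ} {F' x : ℝ} {U : Set ℝ}
    (h : HasDerivAt F F' x) (hU : IsOpen U) (hx : x ∈ U) (h0 : ∀ y ∈ U, F y = 0) : F' = 0 := by
  have he : F =ᶠ[𝓝 x] fun _ => (0 : ℝ) :=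
    Filter.eventually_of_mem (hU.mem_nhds hx) h0
  exact (h.congr_of_eventuallyEq he.symm).unique (hasDerivAt_const x 0)

/-- Eliminating `k` and `k'` leaves a factorised polynomial relation between `p` and `s = sin φ`. -/
theorem profile_relation_factor {p s c k k' l d : ℝ} (hc : c ≠ 0) (hk : k ≠ 0) (hs : s ≠ 0)
    (hcs : s ^ 2 + c ^ 2 = 1) (hkD : k * (2 * s - l * p) = d * c ^ 2 * s)
    (hk' : k' * s * p - c * k * s + c * k ^ 2 * p = -2 * d * c * s ^ 2 * p * k)
    (hderiv : k' * (2 * s - l * p) + k * (2 * (c * k) - l * c)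
      = d * (c ^ 3 * k - 2 * c * s ^ 2 * k)) :
    (l * p - s) * (d * s * p * (l * p - s) - (l + d) * p + 2 * s) = 0 := by
  have hkp : k * p = (d + l) * p - s - d * l * s * p ^ 2 := by
    have : c * k * s * (k * p - ((d + l) * p - s - d * l * s * p ^ 2)) = 0 := by
      linear_combination (s * p * hderiv - (2 * s - l * p) * hk' + c * k * p * hkD) / 2
        + p * d * c * k * s * hcs
    have h0 : c * k * s ≠ 0 := by positivity
    linarith [(mul_eq_zero.mp this).resolve_left h0]
  linear_combination p * hkD - (2 * s - l * p) * hkp + d * s * p * hcs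

/-- The second factor of `profile_relation_factor` and its derivative have no common zero
apart from degenerate ones. -/
theorem profile_relation_degenerate {p s c k l d : ℝ} (hp : p ≠ 0) (hs : s ≠ 0) (hc : c ≠ 0)
    (hd : d ≠ 0) (hdl : d ≠ l)
    (hcs : s ^ 2 + c ^ 2 = 1) (hkD : k * (2 * s - l * p) = d * c ^ 2 * s)
    (hG : d * s * p * (l * p - s) - (l + d) * p + 2 * s = 0)
    (hG' : d * (k * p * (l * p - s) + s * (l * p - s) + s * p * (l - k)) - (l + d) + 2 * k = 0) :
    l * p - s = 0 := by
  have hD : 2 * s - l * p ≠ 0 := by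
    intro h
    rw [h, mul_zero] at hkD
    exact (by positivity : d * c ^ 2 * s ≠ 0) hkD.symm
  have key : (l * p - s) * (((2 * s - l * p) ^ 2 * (d - l) * p) * ((l + d) * p - 2 * s)) = 0 := by
    have hR : (2 * s - l * p) * (d * (s * (l * p - s) + s * p * l) - (l + d))
        + (2 - d * p * (2 * s - l * p)) * (d * (1 - s ^ 2) * s) = 0 := by
      linear_combination (2 * s - l * p) * hG' - (2 - d * p * (2 * s - l * p)) * hkD
        - (2 - d * p * (2 * s - l * p)) * d * s * hcs
    clear hG' hkD hcs
    grind
  rcases mul_eq_zero.mp key with h | h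
  · exact h
  have h2 : (2 * s - l * p) ^ 2 * (d - l) * p ≠ 0 :=
    mul_ne_zero (mul_ne_zero (pow_ne_zero 2 hD) (sub_ne_zero.mpr hdl)) hp
  have hN := (mul_eq_zero.mp h).resolve_left h2
  have : d * s * p * (l * p - s) = 0 := by linarith
  exact (mul_eq_zero.mp this).resolve_left (by positivity)

/-- A surface of revolution with nonvanishing Gauss curvature whose position vector
satisfies `Δ^II x = A x` for a real 3×3 matrix `A` has `H ≡ 0` (catenoid) or
`p² + q²` constant (part of a sphere). -/
theorem surface_of_revolution_coordinate_finite_II_type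
    {a b : ℝ} (hab : a < b) (p q φ H : ℝ → ℝ)
    (hp : ContDiff ℝ (⊤ : ℕ∞) p) (hq : ContDiff ℝ (⊤ : ℕ∞) q) (hφ : ContDiff ℝ (⊤ : ℕ∞) φ)
    (hppos : ∀ u ∈ Ioo a b, 0 < p u)
    (hunit : ∀ u ∈ Ioo a b, deriv p u ^ 2 + deriv q u ^ 2 = 1)
    (hp' : ∀ u ∈ Ioo a b, deriv p u = Real.cos (φ u))
    (hq' : ∀ u ∈ Ioo a b, deriv q u = Real.sin (φ u))
    (hφ' : ∀ u ∈ Ioo a b, deriv φ u ≠ 0)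
    (hsin : ∀ u ∈ Ioo a b, Real.sin (φ u) ≠ 0)
    (hH : ∀ u ∈ Ioo a b, 2 * H u = deriv φ u + Real.sin (φ u) / p u)
    (A : Matrix (Fin 3) (Fin 3) ℝ)
    (h1 : ∀ u ∈ Ioo a b, ∀ v : ℝ,
      DeltaII p φ (fun s t => p s * Real.cos t) u v =
        A 0 0 * (p u * Real.cos v) + A 0 1 * (p u * Real.sin v) + A 0 2 * q u)
    (h2 : ∀ u ∈ Ioo a b, ∀ v : ℝ,
      DeltaII p φ (fun s t => p s * Real.sin t) u v =
        A 1 0 * (p u * Real.cos v) + A 1 1 * (p u * Real.sin v) + A 1 2 * q u)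
    (h3 : ∀ u ∈ Ioo a b, ∀ v : ℝ,
      DeltaII p φ (fun s _ => q s) u v =
        A 2 0 * (p u * Real.cos v) + A 2 1 * (p u * Real.sin v) + A 2 2 * q u) :
    (∀ u ∈ Ioo a b, H u = 0) ∨ (∃ c : ℝ, ∀ u ∈ Ioo a b, p u ^ 2 + q u ^ 2 = c) := by
  have dp : ∀ u ∈ Ioo a b, HasDerivAt p (cos (φ u)) u := fun u hu =>
    hp' u hu ▸ (hp.differentiable (by simp) u).hasDerivAt
  have dq : ∀ u ∈ Ioo a b, HasDerivAt q (sin (φ u)) u := fun u hu =>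
    hq' u hu ▸ (hq.differentiable (by simp) u).hasDerivAt
  have dφ : ∀ u, HasDerivAt φ (deriv φ u) u := fun u =>
    (hφ.differentiable (by simp) u).hasDerivAt
  have ds : ∀ u, HasDerivAt (fun t => sin (φ t)) (cos (φ u) * deriv φ u) u := fun u => (dφ u).sin
  have dc : ∀ u, HasDerivAt (fun t => cos (φ t)) (-sin (φ u) * deriv φ u) u := fun u => (dφ u).cos
  have dk : ∀ u, HasDerivAt (deriv φ) (deriv (deriv φ) u) u := fun u =>
    ((((contDiff_infty_iff_deriv (𝕜 := ℝ)).mp hφ).2).differentiable (by simp) u).hasDerivAt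
  have ddp : ∀ u ∈ Ioo a b, deriv (deriv p) u = -sin (φ u) * deriv φ u := fun u hu =>
    ((dc u).congr_of_eventuallyEq
      (Filter.eventually_of_mem (isOpen_Ioo.mem_nhds hu) hp')).deriv
  have ddq : ∀ u ∈ Ioo a b, deriv (deriv q) u = cos (φ u) * deriv φ u := fun u hu =>
    ((ds u).congr_of_eventuallyEq
      (Filter.eventually_of_mem (isOpen_Ioo.mem_nhds hu) hq')).deriv
  obtain ⟨l, hl⟩ : ∃ l, l = A 0 0 := ⟨_, rfl⟩
  obtain ⟨m, hm⟩ : ∃ m, m = A 2 2 := ⟨_, rfl⟩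
  have ddcos : ∀ r v : ℝ, deriv (deriv fun t => r * cos t) v = -(r * cos v) := by
    intro r v
    have : deriv (fun t => r * cos t) = fun t => -(r * sin t) := by
      ext t; simp
    rw [this]; simp
  have hDelta_p : ∀ u ∈ Ioo a b, sin (φ u) + 1 / sin (φ u) + (1 / 2) * (deriv (deriv φ) u /
      (deriv φ u) ^ 2 - (cos (φ u) * sin (φ u) + p u * deriv φ u * cos (φ u))
        / (p u * deriv φ u * sin (φ u))) * cos (φ u) = l * p u := by
    intro u hu
    have e0 := h1 u hu 0
    have e1 := h1 u hu π
    simp only [DeltaII, deriv_mul_const_field, ddcos, ddp u hu, hp' u hu, cos_zero, cos_pi,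
      sin_zero, sin_pi, ← hl] at e0 e1
    have hp0 := (hppos u hu).ne'
    have hk0 := hφ' u hu
    have hs0 := hsin u hu
    have r1 : -(1 / deriv φ u) * (-sin (φ u) * deriv φ u) = sin (φ u) := by field_simp
    have r2 : 1 / (p u * sin (φ u)) * p u = 1 / sin (φ u) := by field_simp
    linear_combination (e0 - e1) / 2 - r1 - r2
  have hDelta_q : ∀ u ∈ Ioo a b, -cos (φ u) + (1 / 2) * (deriv (deriv φ) u /
      (deriv φ u) ^ 2 - (cos (φ u) * sin (φ u) + p u * deriv φ u * cos (φ u))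
        / (p u * deriv φ u * sin (φ u))) * sin (φ u) = m * q u := by
    intro u hu
    have e0 := h3 u hu 0
    have e1 := h3 u hu π
    have hd0 : deriv (fun s => deriv (fun t => q t) s) u = cos (φ u) * deriv φ u := ddq u hu
    have hd1 : deriv (fun t => q t) u = sin (φ u) := hq' u hu
    simp only [DeltaII, hd0, hd1, deriv_const', cos_zero, cos_pi,
      sin_zero, sin_pi, ← hm] at e0 e1
    have hk0 := hφ' u hu
    have r1 : -(1 / deriv φ u) * (cos (φ u) * deriv φ u) = -cos (φ u) := by field_simp
    linear_combination (e0 + e1) / 2 - r1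
  have hcs : ∀ u, sin (φ u) ^ 2 + cos (φ u) ^ 2 = 1 := fun u => sin_sq_add_cos_sq _
  have hrel : ∀ u ∈ Ioo a b, l * p u * sin (φ u) - m * q u * cos (φ u) - 2 = 0 := by
    intro u hu
    have hs0 := hsin u hu
    have r : sin (φ u) * (1 / sin (φ u)) = 1 := by field_simp
    linear_combination -sin (φ u) * hDelta_p u hu + cos (φ u) * hDelta_q u hu + hcs u + r
  have hrel_deriv : ∀ u ∈ Ioo a b, (l - m) * cos (φ u) * sin (φ u) +
      deriv φ u * (l * p u * cos (φ u) + m * q u * sin (φ u)) = 0 := by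
    intro u hu
    have h := ((((dp u hu).const_mul l).mul (ds u)).sub
      (((dq u hu).const_mul m).mul (dc u))).sub_const 2
    linear_combination h.eq_zero_of_eqOn_isOpen isOpen_Ioo hu hrel
  by_cases hlm : l = m
  · right
    have hl0 : l ≠ 0 := by
      rintro rfl
      have := hrel ((a + b) / 2) ⟨by linarith, by linarith⟩
      rw [← hlm] at this
      norm_num at this
    have hd : ∀ u ∈ Ioo a b, HasDerivAt (fun t => p t ^ 2 + q t ^ 2) 0 u := by
      intro u hu
      have h := ((dp u hu).pow 2).add ((dq u hu).pow 2)
      have h0 : deriv φ u * l * (p u * cos (φ u) + q u * sin (φ u)) = 0 := by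
        have := hrel_deriv u hu
        rw [← hlm] at this
        linear_combination this
      have hpq := (mul_eq_zero.mp h0).resolve_left (mul_ne_zero (hφ' u hu) hl0)
      refine h.congr_deriv ?_
      push_cast
      linear_combination 2 * hpq
    obtain ⟨c, hc⟩ := isOpen_Ioo.exists_is_const_of_deriv_eq_zero isPreconnected_Ioo
      (fun u hu => (hd u hu).differentiableAt.differentiableWithinAt)
      (fun u hu => (hd u hu).deriv)
    exact ⟨c, hc⟩
  left
  have hcos_open : ∀ U : Set ℝ, IsOpen U → U ⊆ Ioo a b → (∀ u ∈ U, cos (φ u) = 0) → ∀ u, u ∉ U := by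
    intro U hU hUI h0 u hu
    exact mul_ne_zero (neg_ne_zero.mpr (hsin u (hUI hu))) (hφ' u (hUI hu))
      ((dc u).eq_zero_of_eqOn_isOpen hU hu h0)
  by_cases hm0 : m = 0
  · subst hm0
    have hne : ∀ u ∈ Ioo a b, sin (φ u) + p u * deriv φ u = 0 := by
      intro u hu
      by_contra hne
      have hcont : Continuous fun t => sin (φ t) + p t * deriv φ t :=
        (continuous_sin.comp hφ.continuous).add
          (hp.continuous.mul (continuous_iff_continuousAt.mpr fun t => (dk t).continuousAt))
      refine hcos_open (Ioo a b ∩ {t | sin (φ t) + p t * deriv φ t ≠ 0})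
        (isOpen_Ioo.inter (isOpen_ne_fun hcont continuous_const)) inter_subset_left ?_ u ⟨hu, hne⟩
      rintro t ⟨ht, ht0⟩
      have h : l * (sin (φ t) + p t * deriv φ t) * cos (φ t) = 0 := by
        linear_combination hrel_deriv t ht
      exact (mul_eq_zero.mp h).resolve_left (mul_ne_zero hlm ht0)
    intro u hu
    have hp0 := (hppos u hu).ne'
    have h : 2 * H u * p u = 0 := by
      rw [hH u hu]
      field_simp
      linear_combination hne u hu
    have := (mul_eq_zero.mp h).resolve_right hp0
    linarith
  exfalso
  set d := l - m with hd_def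
  have hd : d ≠ 0 := sub_ne_zero.mpr hlm
  have hdl : d ≠ l := fun h => hm0 (by linarith)
  have hode : ∀ u ∈ Ioo a b, deriv (deriv φ) u * sin (φ u) * p u - cos (φ u) * deriv φ u * sin (φ u)
      + cos (φ u) * deriv φ u ^ 2 * p u =
      -2 * d * cos (φ u) * sin (φ u) ^ 2 * p u * deriv φ u := by
    intro u hu
    have hp0 := (hppos u hu).ne'
    have hk0 := hφ' u hu
    have hs0 := hsin u hu
    have e1 := hDelta_p u hu
    have e2 := hDelta_q u hu
    have h : cos (φ u) / sin (φ u) + (1 / 2) * (deriv (deriv φ) u / deriv φ u ^ 2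
        - (cos (φ u) * sin (φ u) + p u * deriv φ u * cos (φ u)) / (p u * deriv φ u * sin (φ u)))
        = l * p u * cos (φ u) + m * q u * sin (φ u) := by
      have r : cos (φ u) * (1 / sin (φ u)) = cos (φ u) / sin (φ u) := by ring
      linear_combination cos (φ u) * e1 + sin (φ u) * e2 - r
        - (1 / 2) * (deriv (deriv φ) u / deriv φ u ^ 2 - (cos (φ u) * sin (φ u)
          + p u * deriv φ u * cos (φ u)) / (p u * deriv φ u * sin (φ u))) * hcs u
    field_simp at h
    linear_combination h + 2 * sin (φ u) * p u * deriv φ u * hrel_deriv u hu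
  have hkD : ∀ u ∈ Ioo a b, deriv φ u * (2 * sin (φ u) - l * p u)
      - d * cos (φ u) ^ 2 * sin (φ u) = 0 := by
    intro u hu
    linear_combination -cos (φ u) * hrel_deriv u hu - deriv φ u * sin (φ u) * hrel u hu
      + deriv φ u * l * p u * hcs u
  have hkD_deriv : ∀ u ∈ Ioo a b, deriv (deriv φ) u * (2 * sin (φ u) - l * p u)
      + deriv φ u * (2 * (cos (φ u) * deriv φ u) - l * cos (φ u))
      = d * (cos (φ u) ^ 3 * deriv φ u - 2 * cos (φ u) * sin (φ u) ^ 2 * deriv φ u) := by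
    intro u hu
    have h := ((dk u).mul (((ds u).const_mul 2).sub ((dp u hu).const_mul l))).sub
      ((((dc u).pow 2).const_mul d).mul (ds u))
    have h0 := h.eq_zero_of_eqOn_isOpen isOpen_Ioo hu hkD
    simp only [Pi.sub_apply, Pi.pow_apply] at h0
    push_cast at h0
    linear_combination h0
  let O : Set ℝ := Ioo a b ∩ {t | cos (φ t) ≠ 0}
  have hO : IsOpen O :=
    isOpen_Ioo.inter (isOpen_ne_fun (continuous_cos.comp hφ.continuous) continuous_const)
  have hprod : ∀ u ∈ O, (l * p u - sin (φ u)) * (d * sin (φ u) * p u * (l * p u - sin (φ u))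
      - (l + d) * p u + 2 * sin (φ u)) = 0 := fun u hu =>
    profile_relation_factor hu.2 (hφ' u hu.1) (hsin u hu.1) (hcs u)
      (sub_eq_zero.mp (hkD u hu.1)) (hode u hu.1) (hkD_deriv u hu.1)
  have hlin : ∀ u ∈ O, l * p u - sin (φ u) = 0 := by
    intro u hu
    by_contra hne
    let V : Set ℝ := O ∩ {t | l * p t - sin (φ t) ≠ 0}
    have hV : IsOpen V := hO.inter (isOpen_ne_fun
      ((continuous_const.mul hp.continuous).sub (continuous_sin.comp hφ.continuous))
      continuous_const)
    have hG : ∀ t ∈ V, d * sin (φ t) * p t * (l * p t - sin (φ t))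
        - (l + d) * p t + 2 * sin (φ t) = 0 := fun t ht =>
      (mul_eq_zero.mp (hprod t ht.1)).resolve_left ht.2
    have h := ((((((ds u).const_mul d).mul (dp u hu.1)).mul
      (((dp u hu.1).const_mul l).sub (ds u))).sub ((dp u hu.1).const_mul (l + d))).add
      ((ds u).const_mul 2))
    have h0 := h.eq_zero_of_eqOn_isOpen hV ⟨hu, hne⟩ hG
    refine hne (profile_relation_degenerate (hppos u hu.1).ne' (hsin u hu.1) hu.2 hd hdl (hcs u)
      (sub_eq_zero.mp (hkD u hu.1)) (hG u ⟨hu, hne⟩) (mul_left_cancel₀ hu.2 ?_))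
    simp only [Pi.mul_apply, Pi.sub_apply] at h0
    linear_combination h0
  have hconst : ∀ u ∈ O, d * cos (φ u) ^ 2 - l = 0 := by
    intro u hu
    have h0 := (((dp u hu.1).const_mul l).sub (ds u)).eq_zero_of_eqOn_isOpen hO hu hlin
    have hkl : l = deriv φ u := mul_left_cancel₀ hu.2 (by linear_combination h0)
    refine mul_left_cancel₀ (hsin u hu.1) ?_
    linear_combination -hkD u hu.1 - deriv φ u * hlin u hu - sin (φ u) * hkl
  have hempty : ∀ u, u ∉ O := by
    intro u hu
    have h0 := ((((dc u).pow 2).const_mul d).sub_const l).eq_zero_of_eqOn_isOpen hO hu hconst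
    push_cast at h0
    have : d * cos (φ u) * sin (φ u) * deriv φ u = 0 := by linear_combination -h0 / 2
    exact mul_ne_zero (mul_ne_zero (mul_ne_zero hd hu.2) (hsin u hu.1)) (hφ' u hu.1) this
  refine hcos_open (Ioo a b) isOpen_Ioo subset_rfl (fun u hu => ?_) ((a + b) / 2)
    ⟨by linarith, by linarith⟩
  by_contra hne
  exact hempty u ⟨hu, hne⟩
end

section
/- The Laplace operator Δ^II of the second fundamental form applied to the first two coordinate functions of the surface of revolution satisfies Δ^II(p cos v) = (sin φ + 1/sin φ + (φ'' cos φ)/(2φ'²) − (H cos²φ)/(φ' sin φ)) · cos v and Δ^II(p sin v) = (sin φ + 1/sin φ + (φ'' cos φ)/(2φ'²) − (H cos²φ)/(φ' sin φ)) · sin v, where 2H = φ' + sin φ/p. -/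
open Real Set

/-- The operator `Δ^II` on a product `p(u) g(v)` with `g'' = -g`. -/
theorem DeltaII_mul_of_deriv_deriv_eq_neg {p φ g : ℝ → ℝ} {u v h : ℝ}
    (hφ : DifferentiableAt ℝ φ u) (hp0 : p u ≠ 0)
    (hp : deriv p =ᶠ[nhds u] fun s => Real.cos (φ s))
    (hφ' : deriv φ u ≠ 0) (hsin : Real.sin (φ u) ≠ 0)
    (hh : 2 * h = deriv φ u + Real.sin (φ u) / p u)
    (hg : deriv (deriv g) v = -g v) :
    DeltaII p φ (fun s t => p s * g t) u v =
      (Real.sin (φ u) + 1 / Real.sin (φ u)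
        + deriv (deriv φ) u * Real.cos (φ u) / (2 * deriv φ u ^ 2)
        - h * Real.cos (φ u) ^ 2 / (deriv φ u * Real.sin (φ u))) * g v := by
  have hpp : deriv (deriv p) u = -Real.sin (φ u) * deriv φ u :=
    hp.deriv_eq.trans hφ.hasDerivAt.cos.deriv
  have hgp : deriv (fun t => p u * g t) = fun t => p u * deriv g t :=
    funext fun t => deriv_const_mul_field _
  obtain rfl : h = (deriv φ u + Real.sin (φ u) / p u) / 2 := by linarith
  simp only [DeltaII, deriv_mul_const_field, hgp, deriv_const_mul_field, hpp, hp.eq_of_nhds, hg]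
  field_simp
  ring

/-- `Δ^II(p cos v)` and `Δ^II(p sin v)` equal
`(sin φ + 1/sin φ + φ''cos φ/(2φ'²) − H cos²φ/(φ' sin φ))` times `cos v`, `sin v`
respectively, where `2H = φ' + sin φ/p`. -/
theorem DeltaII_first_two_coordinates
    {a b : ℝ} (hab : a < b) (p q φ H : ℝ → ℝ)
    (hp : ContDiff ℝ (⊤ : ℕ∞) p) (hq : ContDiff ℝ (⊤ : ℕ∞) q) (hφ : ContDiff ℝ (⊤ : ℕ∞) φ)
    (hppos : ∀ u ∈ Ioo a b, 0 < p u)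
    (hp' : ∀ u ∈ Ioo a b, deriv p u = Real.cos (φ u))
    (hq' : ∀ u ∈ Ioo a b, deriv q u = Real.sin (φ u))
    (hφ' : ∀ u ∈ Ioo a b, deriv φ u ≠ 0)
    (hsin : ∀ u ∈ Ioo a b, Real.sin (φ u) ≠ 0)
    (hH : ∀ u ∈ Ioo a b, 2 * H u = deriv φ u + Real.sin (φ u) / p u) :
    ∀ u ∈ Ioo a b, ∀ v : ℝ,
      DeltaII p φ (fun s t => p s * Real.cos t) u v =
        (Real.sin (φ u) + 1 / Real.sin (φ u)
          + deriv (deriv φ) u * Real.cos (φ u) / (2 * deriv φ u ^ 2)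
          - H u * Real.cos (φ u) ^ 2 / (deriv φ u * Real.sin (φ u))) * Real.cos v ∧
      DeltaII p φ (fun s t => p s * Real.sin t) u v =
        (Real.sin (φ u) + 1 / Real.sin (φ u)
          + deriv (deriv φ) u * Real.cos (φ u) / (2 * deriv φ u ^ 2)
          - H u * Real.cos (φ u) ^ 2 / (deriv φ u * Real.sin (φ u))) * Real.sin v := by
  intro u hu v
  have hcos : deriv p =ᶠ[nhds u] fun s => Real.cos (φ s) :=
    Filter.eventually_of_mem (isOpen_Ioo.mem_nhds hu) hp'
  have hφd : DifferentiableAt ℝ φ u := hφ.differentiable (by simp) u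
  constructor <;>
    exact DeltaII_mul_of_deriv_deriv_eq_neg hφd (hppos u hu).ne' hcos (hφ' u hu) (hsin u hu)
      (hH u hu) (by simp)
end

section
/- The Laplace operator Δ^II of the second fundamental form applied to the third coordinate function of the surface of revolution satisfies Δ^II(q) = −(3/2)cos φ + (φ'' sin φ)/(2φ'²) − (sin φ cos φ)/(2 p φ'). -/
open Real Set

/-- `Δ^II(q) = −(3/2)cos φ + φ''sin φ/(2φ'²) − sin φ cos φ/(2pφ')`. -/
theorem DeltaII_third_coordinate
    {a b : ℝ} (hab : a < b) (p q φ : ℝ → ℝ)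
    (hp : ContDiff ℝ (⊤ : ℕ∞) p) (hq : ContDiff ℝ (⊤ : ℕ∞) q) (hφ : ContDiff ℝ (⊤ : ℕ∞) φ)
    (hppos : ∀ u ∈ Ioo a b, 0 < p u)
    (hp' : ∀ u ∈ Ioo a b, deriv p u = Real.cos (φ u))
    (hq' : ∀ u ∈ Ioo a b, deriv q u = Real.sin (φ u))
    (hφ' : ∀ u ∈ Ioo a b, deriv φ u ≠ 0)
    (hsin : ∀ u ∈ Ioo a b, Real.sin (φ u) ≠ 0) :
    ∀ u ∈ Ioo a b, ∀ v : ℝ,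
      DeltaII p φ (fun s _ => q s) u v =
        -(3 / 2) * Real.cos (φ u)
          + deriv (deriv φ) u * Real.sin (φ u) / (2 * deriv φ u ^ 2)
          - Real.sin (φ u) * Real.cos (φ u) / (2 * p u * deriv φ u) := by
  intro u hu v
  have hqq : deriv (fun s => deriv q s) u = Real.cos (φ u) * deriv φ u := by
    have heq : (fun s => deriv q s) =ᶠ[nhds u] fun s => Real.sin (φ s) :=
      Filter.eventuallyEq_of_mem (isOpen_Ioo.mem_nhds hu) hq'
    have hφd : DifferentiableAt ℝ φ u := (hφ.differentiable (by simp)).differentiableAt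
    rw [heq.deriv_eq, hφd.hasDerivAt.sin.deriv]
  have h0 : deriv (deriv fun _ : ℝ => q u) v = 0 := by simp
  have hpu := (hppos u hu).ne'
  have hφu := hφ' u hu
  have hsu := hsin u hu
  simp only [DeltaII]
  rw [hqq, h0, hq' u hu]
  field_simp
  ring
end

section
/- Let A = (a_ij) be a real 3×3 matrix, let (a,b) be a nonempty open interval, and let f, g, p, q : (a,b) → ℝ with p > 0 on (a,b) and q not identically zero on (a,b). Suppose that for all u ∈ (a,b) and all v ∈ ℝ: f(u)cos v = a₁₁ p(u)cos v + a₁₂ p(u)sin v + a₁₃ q(u), f(u)sin v = a₂₁ p(u)cos v + a₂₂ p(u)sin v + a₂₃ q(u), and g(u) = a₃₁ p(u)cos v + a₃₂ p(u)sin v + a₃₃ q(u). Then a₁₂ = a₁₃ = a₂₁ = a₂₃ = a₃₁ = a₃₂ = 0 and a₁₁ = a₂₂; moreover f = a₁₁ p and g = a₃₃ q on (a,b). -/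
open Real Set

/-- The functions `cos`, `sin` and `1` are linearly independent over `ℝ`. -/
theorem eq_zero_of_forall_cos_add_sin_add_eq_zero {α β γ : ℝ}
    (h : ∀ v : ℝ, α * Real.cos v + β * Real.sin v + γ = 0) : α = 0 ∧ β = 0 ∧ γ = 0 := by
  have h_zero := h 0
  have h_pi := h π
  have h_half := h (π / 2)
  simp only [Real.cos_zero, Real.sin_zero, Real.cos_pi, Real.sin_pi, Real.cos_pi_div_two,
    Real.sin_pi_div_two] at h_zero h_pi h_half
  refine ⟨?_, ?_, ?_⟩ <;> linarith

/-- If `f(u)cos v = a₁₁p cos v + a₁₂p sin v + a₁₃q`,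
`f(u)sin v = a₂₁p cos v + a₂₂p sin v + a₂₃q`, and
`g(u) = a₃₁p cos v + a₃₂p sin v + a₃₃q` hold for all `u ∈ (a,b)`, `v ∈ ℝ`, with `p > 0`
and `q` not identically zero on `(a,b)`, then
`a₁₂ = a₁₃ = a₂₁ = a₂₃ = a₃₁ = a₃₂ = 0`, `a₁₁ = a₂₂`, and `f = a₁₁p`, `g = a₃₃q`. -/
theorem matrix_reduction_to_diagonal
    {a b : ℝ} (hab : a < b) (A : Matrix (Fin 3) (Fin 3) ℝ)
    (f g p q : ℝ → ℝ)
    (hppos : ∀ u ∈ Ioo a b, 0 < p u)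
    (hqne : ∃ u ∈ Ioo a b, q u ≠ 0)
    (h1 : ∀ u ∈ Ioo a b, ∀ v : ℝ,
      f u * Real.cos v = A 0 0 * p u * Real.cos v + A 0 1 * p u * Real.sin v + A 0 2 * q u)
    (h2 : ∀ u ∈ Ioo a b, ∀ v : ℝ,
      f u * Real.sin v = A 1 0 * p u * Real.cos v + A 1 1 * p u * Real.sin v + A 1 2 * q u)
    (h3 : ∀ u ∈ Ioo a b, ∀ v : ℝ,
      g u = A 2 0 * p u * Real.cos v + A 2 1 * p u * Real.sin v + A 2 2 * q u) :
    A 0 1 = 0 ∧ A 0 2 = 0 ∧ A 1 0 = 0 ∧ A 1 2 = 0 ∧ A 2 0 = 0 ∧ A 2 1 = 0 ∧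
    A 0 0 = A 1 1 ∧
    (∀ u ∈ Ioo a b, f u = A 0 0 * p u) ∧ (∀ u ∈ Ioo a b, g u = A 2 2 * q u) := by
  have key1 : ∀ u ∈ Ioo a b, A 0 0 * p u - f u = 0 ∧ A 0 1 * p u = 0 ∧ A 0 2 * q u = 0 :=
    fun u hu => eq_zero_of_forall_cos_add_sin_add_eq_zero fun v => by linarith [h1 u hu v]
  have key2 : ∀ u ∈ Ioo a b, A 1 0 * p u = 0 ∧ A 1 1 * p u - f u = 0 ∧ A 1 2 * q u = 0 :=
    fun u hu => eq_zero_of_forall_cos_add_sin_add_eq_zero fun v => by linarith [h2 u hu v]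
  have key3 : ∀ u ∈ Ioo a b, A 2 0 * p u = 0 ∧ A 2 1 * p u = 0 ∧ A 2 2 * q u - g u = 0 :=
    fun u hu => eq_zero_of_forall_cos_add_sin_add_eq_zero fun v => by linarith [h3 u hu v]
  obtain ⟨w, hw, hq⟩ := hqne
  have hp : p w ≠ 0 := (hppos w hw).ne'
  obtain ⟨h00, h01, h02⟩ := key1 w hw
  obtain ⟨h10, h11, h12⟩ := key2 w hw
  obtain ⟨h20, h21, -⟩ := key3 w hw
  exact ⟨(mul_eq_zero_iff_right hp).mp h01, (mul_eq_zero_iff_right hq).mp h02,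
    (mul_eq_zero_iff_right hp).mp h10, (mul_eq_zero_iff_right hq).mp h12,
    (mul_eq_zero_iff_right hp).mp h20, (mul_eq_zero_iff_right hp).mp h21,
    mul_right_cancel₀ hp (by linarith),
    fun u hu => by linarith [(key1 u hu).1], fun u hu => by linarith [(key3 u hu).2.2]⟩
end

section
/- Let p, φ', φ'' be real numbers with p ≠ 0, φ' ≠ 0 and sin φ ≠ 0, and set 2H = φ' + sin φ/p. Then sin φ · (sin φ + 1/sin φ + (φ'' cos φ)/(2φ'²) − (H cos²φ)/(φ' sin φ)) − cos φ · (−(3/2)cos φ + (φ'' sin φ)/(2φ'²) − (sin φ cos φ)/(2 p φ')) = 2. -/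
open Real

/-- The key algebraic identity: with `2H = φ' + sin φ/p`, `p ≠ 0`, `φ' ≠ 0`, `sin φ ≠ 0`,
`sin φ · (Δ^II(p cos v)/cos v) − cos φ · Δ^II(q) = 2`, where the two factors are the
displayed expressions. Here `φ₁` stands for `φ'` and `φ₂` for `φ''`. -/
theorem key_algebraic_identity
    (p φ φ₁ φ₂ H : ℝ) (hp : p ≠ 0) (hφ₁ : φ₁ ≠ 0) (hsin : Real.sin φ ≠ 0)
    (hH : 2 * H = φ₁ + Real.sin φ / p) :
    Real.sin φ * (Real.sin φ + 1 / Real.sin φ + φ₂ * Real.cos φ / (2 * φ₁ ^ 2)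
        - H * Real.cos φ ^ 2 / (φ₁ * Real.sin φ))
      - Real.cos φ * (-(3 / 2) * Real.cos φ + φ₂ * Real.sin φ / (2 * φ₁ ^ 2)
        - Real.sin φ * Real.cos φ / (2 * p * φ₁)) = 2 := by
  obtain rfl : H = (φ₁ + Real.sin φ / p) / 2 := by linarith
  have expand : Real.sin φ * (Real.sin φ + 1 / Real.sin φ + φ₂ * Real.cos φ / (2 * φ₁ ^ 2)
        - (φ₁ + Real.sin φ / p) / 2 * Real.cos φ ^ 2 / (φ₁ * Real.sin φ))
      - Real.cos φ * (-(3 / 2) * Real.cos φ + φ₂ * Real.sin φ / (2 * φ₁ ^ 2)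
        - Real.sin φ * Real.cos φ / (2 * p * φ₁))
      = Real.sin φ ^ 2 + Real.cos φ ^ 2 + 1 := by
    field_simp
    ring
  rw [expand, Real.sin_sq_add_cos_sq]
  norm_num
end

section
/- (Case λ = μ = 0.) There is no point u₀ ∈ (a,b) at which both sin φ + 1/sin φ + (φ'' cos φ)/(2φ'²) − (H cos²φ)/(φ' sin φ) = 0 and −(3/2)cos φ + (φ'' sin φ)/(2φ'²) − (sin φ cos φ)/(2 p φ') = 0 hold simultaneously. -/
open Real Set

/-- Case λ = μ = 0: there is no point of (a,b) at which both Δ^II(p cos v)/cos v and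
Δ^II(q) vanish. -/
theorem case_I_no_point
    {a b : ℝ} (hab : a < b) (p q φ H : ℝ → ℝ)
    (hp : ContDiff ℝ (⊤ : ℕ∞) p) (hq : ContDiff ℝ (⊤ : ℕ∞) q) (hφ : ContDiff ℝ (⊤ : ℕ∞) φ)
    (hppos : ∀ u ∈ Ioo a b, 0 < p u)
    (hp' : ∀ u ∈ Ioo a b, deriv p u = Real.cos (φ u))
    (hq' : ∀ u ∈ Ioo a b, deriv q u = Real.sin (φ u))
    (hφ' : ∀ u ∈ Ioo a b, deriv φ u ≠ 0)
    (hsin : ∀ u ∈ Ioo a b, Real.sin (φ u) ≠ 0)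
    (hH : ∀ u ∈ Ioo a b, 2 * H u = deriv φ u + Real.sin (φ u) / p u) :
    ¬ ∃ u ∈ Ioo a b,
      (Real.sin (φ u) + 1 / Real.sin (φ u)
          + deriv (deriv φ) u * Real.cos (φ u) / (2 * deriv φ u ^ 2)
          - H u * Real.cos (φ u) ^ 2 / (deriv φ u * Real.sin (φ u)) = 0) ∧
      (-(3 / 2) * Real.cos (φ u)
          + deriv (deriv φ) u * Real.sin (φ u) / (2 * deriv φ u ^ 2)
          - Real.sin (φ u) * Real.cos (φ u) / (2 * p u * deriv φ u) = 0) := by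
  rintro ⟨u, hu, h₁, h₂⟩
  have hpu := (hppos u hu).ne'
  have hd := hφ' u hu
  have hs := hsin u hu
  have hHu : H u = (deriv φ u + Real.sin (φ u) / p u) / 2 := by linarith [hH u hu]
  have hcs := Real.sin_sq_add_cos_sq (φ u)
  rw [hHu] at h₁
  generalize Real.sin (φ u) = s at *
  generalize Real.cos (φ u) = c at *
  generalize deriv (deriv φ) u = e at *
  generalize deriv φ u = d at *
  have key : s * (s + 1 / s + e * c / (2 * d ^ 2) - (d + s / p u) / 2 * c ^ 2 / (d * s))
      - c * (-(3 / 2) * c + e * s / (2 * d ^ 2) - s * c / (2 * p u * d))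
      = s ^ 2 + c ^ 2 + 1 := by
    field_simp
    ring
  rw [h₁, h₂] at key
  linarith
end

section
/- (Case λ = μ ≠ 0: sphere.) Let λ ≠ 0 and suppose that on (a,b): sin φ + 1/sin φ + (φ'' cos φ)/(2φ'²) − (H cos²φ)/(φ' sin φ) = λ p and −(3/2)cos φ + (φ'' sin φ)/(2φ'²) − (sin φ cos φ)/(2 p φ') = λ q. Then p² + q² is constant on (a,b), i.e. the profile curve is part of a circle centered at the origin and the surface is part of a sphere. -/
open Real Set

/-- Case λ = μ ≠ 0: the profile curve is part of a circle centered at the origin,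
i.e. p² + q² is constant, so the surface is part of a sphere. -/
theorem case_II_sphere
    {a b : ℝ} (hab : a < b) (p q φ H : ℝ → ℝ)
    (hp : ContDiff ℝ (⊤ : ℕ∞) p) (hq : ContDiff ℝ (⊤ : ℕ∞) q) (hφ : ContDiff ℝ (⊤ : ℕ∞) φ)
    (hppos : ∀ u ∈ Ioo a b, 0 < p u)
    (hp' : ∀ u ∈ Ioo a b, deriv p u = Real.cos (φ u))
    (hq' : ∀ u ∈ Ioo a b, deriv q u = Real.sin (φ u))
    (hφ' : ∀ u ∈ Ioo a b, deriv φ u ≠ 0)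
    (hsin : ∀ u ∈ Ioo a b, Real.sin (φ u) ≠ 0)
    (hH : ∀ u ∈ Ioo a b, 2 * H u = deriv φ u + Real.sin (φ u) / p u)
    (lam : ℝ) (hlam : lam ≠ 0)
    (h1 : ∀ u ∈ Ioo a b, Real.sin (φ u) + 1 / Real.sin (φ u)
          + deriv (deriv φ) u * Real.cos (φ u) / (2 * deriv φ u ^ 2)
          - H u * Real.cos (φ u) ^ 2 / (deriv φ u * Real.sin (φ u)) = lam * p u)
    (h2 : ∀ u ∈ Ioo a b, -(3 / 2) * Real.cos (φ u)
          + deriv (deriv φ) u * Real.sin (φ u) / (2 * deriv φ u ^ 2)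
          - Real.sin (φ u) * Real.cos (φ u) / (2 * p u * deriv φ u) = lam * q u) :
    ∃ c : ℝ, ∀ u ∈ Ioo a b, p u ^ 2 + q u ^ 2 = c := by
  have hpd : Differentiable ℝ p := hp.differentiable (by simp)
  have hqd : Differentiable ℝ q := hq.differentiable (by simp)
  have hφd : Differentiable ℝ φ := hφ.differentiable (by simp)
  have hsupport : ∀ u ∈ Ioo a b, p u * Real.sin (φ u) - q u * Real.cos (φ u) = 2 / lam := by
    intro u hu
    have e1 := h1 u hu
    have e2 := h2 u hu
    have hk := hφ' u hu
    have hs := hsin u hu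
    have hpu := (hppos u hu).ne'
    have hHu : H u = (deriv φ u + Real.sin (φ u) / p u) / 2 := by linarith [hH u hu]
    rw [hHu] at e1
    have hcombine : lam * p u * Real.sin (φ u) - lam * q u * Real.cos (φ u)
        = Real.sin (φ u) ^ 2 + 1 + Real.cos (φ u) ^ 2 := by
      rw [← e1, ← e2]
      field_simp
      ring
    rw [eq_div_iff hlam]
    linear_combination hcombine + Real.sin_sq_add_cos_sq (φ u)
  have htangent : ∀ u ∈ Ioo a b, p u * Real.cos (φ u) + q u * Real.sin (φ u) = 0 := by
    intro u hu
    have hd := ((hpd u).hasDerivAt.mul (hφd u).hasDerivAt.sin).sub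
      ((hqd u).hasDerivAt.mul (hφd u).hasDerivAt.cos)
    have hc := (hasDerivAt_const u (2 / lam)).congr_of_eventuallyEq
      (Filter.eventuallyEq_of_mem (isOpen_Ioo.mem_nhds hu) hsupport)
    have heq := hd.unique hc
    rw [hp' u hu, hq' u hu] at heq
    refine (mul_eq_zero.mp ?_).resolve_left (hφ' u hu)
    linear_combination heq
  refine isOpen_Ioo.exists_is_const_of_deriv_eq_zero isPreconnected_Ioo
    (f := fun u => p u ^ 2 + q u ^ 2) ((hpd.pow 2).add (hqd.pow 2)).differentiableOn ?_
  intro u hu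
  have hd := ((hpd u).hasDerivAt.pow 2).add ((hqd u).hasDerivAt.pow 2)
  rw [hp' u hu, hq' u hu] at hd
  refine hd.deriv.trans ?_
  simp only [Pi.zero_apply]
  linear_combination 2 * htangent u hu
end

section
/- (Case λ ≠ 0, μ = 0: catenoid.) Let λ ≠ 0 and suppose that on (a,b): sin φ + 1/sin φ + (φ'' cos φ)/(2φ'²) − (H cos²φ)/(φ' sin φ) = λ p and −(3/2)cos φ + (φ'' sin φ)/(2φ'²) − (sin φ cos φ)/(2 p φ') = 0. Then the mean curvature H vanishes identically on (a,b), i.e. the surface is minimal (a catenoid). -/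
open Real Set

/-- Case λ ≠ 0, μ = 0: the mean curvature vanishes identically, so the surface is
minimal (a catenoid). -/
theorem case_III_catenoid
    {a b : ℝ} (hab : a < b) (p q φ H : ℝ → ℝ)
    (hp : ContDiff ℝ (⊤ : ℕ∞) p) (hq : ContDiff ℝ (⊤ : ℕ∞) q) (hφ : ContDiff ℝ (⊤ : ℕ∞) φ)
    (hppos : ∀ u ∈ Ioo a b, 0 < p u)
    (hp' : ∀ u ∈ Ioo a b, deriv p u = Real.cos (φ u))
    (hq' : ∀ u ∈ Ioo a b, deriv q u = Real.sin (φ u))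
    (hφ' : ∀ u ∈ Ioo a b, deriv φ u ≠ 0)
    (hsin : ∀ u ∈ Ioo a b, Real.sin (φ u) ≠ 0)
    (hH : ∀ u ∈ Ioo a b, 2 * H u = deriv φ u + Real.sin (φ u) / p u)
    (lam : ℝ) (hlam : lam ≠ 0)
    (h1 : ∀ u ∈ Ioo a b, Real.sin (φ u) + 1 / Real.sin (φ u)
          + deriv (deriv φ) u * Real.cos (φ u) / (2 * deriv φ u ^ 2)
          - H u * Real.cos (φ u) ^ 2 / (deriv φ u * Real.sin (φ u)) = lam * p u)
    (h2 : ∀ u ∈ Ioo a b, -(3 / 2) * Real.cos (φ u)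
          + deriv (deriv φ) u * Real.sin (φ u) / (2 * deriv φ u ^ 2)
          - Real.sin (φ u) * Real.cos (φ u) / (2 * p u * deriv φ u) = 0) :
    ∀ u ∈ Ioo a b, H u = 0 := by
  have hdφ : ∀ u, HasDerivAt φ (deriv φ u) u := fun u =>
    (hφ.differentiable (by simp) u).hasDerivAt
  have hddφ : ∀ u, HasDerivAt (deriv φ) (deriv (deriv φ) u) u := fun u =>
    (((contDiff_infty_iff_deriv.mp hφ).2).differentiable (by simp) u).hasDerivAt
  have hdp : ∀ u ∈ Ioo a b, HasDerivAt p (Real.cos (φ u)) u := fun u hu =>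
    hp' u hu ▸ (hp.differentiable (by simp) u).hasDerivAt
  have deriv_eq_zero : ∀ (F : ℝ → ℝ) (d k : ℝ), (∀ u ∈ Ioo a b, F u = k) →
      ∀ u ∈ Ioo a b, HasDerivAt F d u → d = 0 := by
    intro F d k hF u hu hd
    refine hd.unique ((hasDerivAt_const u k).congr_of_eventuallyEq ?_)
    filter_upwards [isOpen_Ioo.mem_nhds hu] with v hv using hF v hv
  have hps : ∀ u ∈ Ioo a b, p u * Real.sin (φ u) = 2 / lam := by
    intro u hu
    have e1 := h1 u hu
    have e2 := h2 u hu
    have hH' : H u = (deriv φ u + Real.sin (φ u) / p u) / 2 := by linarith [hH u hu]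
    have hpu := (hppos u hu).ne'
    have hf := hφ' u hu
    have hs := hsin u hu
    have hsc := Real.sin_sq_add_cos_sq (φ u)
    rw [hH'] at e1
    have key : 2 / Real.sin (φ u) = lam * p u := by
      rw [← e1]
      have hg : deriv (deriv φ) u / (2 * deriv φ u ^ 2) =
          ((3 / 2) * Real.cos (φ u)
            + Real.sin (φ u) * Real.cos (φ u) / (2 * p u * deriv φ u)) / Real.sin (φ u) := by
        rw [eq_div_iff hs]
        linear_combination e2
      rw [mul_div_right_comm, hg]
      field_simp
      linear_combination (-2 * p u * deriv φ u) * hsc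
    rw [div_eq_iff hs] at key
    rw [eq_div_iff hlam]
    linear_combination -key
  have hcos : ∀ u ∈ Ioo a b,
      Real.cos (φ u) * (Real.sin (φ u) + p u * deriv φ u) = 0 := by
    intro u hu
    have := deriv_eq_zero _ _ _ hps u hu ((hdp u hu).mul (hdφ u).sin)
    linear_combination this
  intro u hu
  have hpu := (hppos u hu).ne'
  have hzero : Real.sin (φ u) + p u * deriv φ u = 0 := by
    rcases mul_eq_zero.mp (hcos u hu) with hc | h
    · have := deriv_eq_zero _ _ _ hcos u hu
        ((hdφ u).cos.mul ((hdφ u).sin.add ((hdp u hu).mul (hddφ u))))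
      simp only [hc, zero_mul, add_zero] at this
      exact (mul_eq_zero.mp this).resolve_left
        (mul_ne_zero (neg_ne_zero.mpr (hsin u hu)) (hφ' u hu))
    · exact h
  have h2H : 2 * H u * p u = 0 := by
    rw [hH u hu]
    field_simp
    linear_combination hzero
  simpa [hpu] using h2H
end

section
/- Let λ, μ be real constants and suppose λ p sin φ − μ q cos φ = 2 on (a,b), where p' = cos φ and q' = sin φ. Set Ω := λ p cos φ + μ q sin φ. Then on (a,b): Ω φ' = (μ − λ) cos φ sin φ, and Ω' = λ cos²φ + μ sin²φ − 2φ'. -/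
open Real Set

/-- If `λ p sin φ − μ q cos φ = 2` on `(a,b)` with `p' = cos φ`, `q' = sin φ`, and
`Ω := λ p cos φ + μ q sin φ`, then `Ω φ' = (μ − λ) cos φ sin φ` and
`Ω' = λ cos²φ + μ sin²φ − 2φ'` on `(a,b)` (identities (3.46)–(3.47)). -/
theorem Omega_identities
    {a b : ℝ} (hab : a < b) (p q φ : ℝ → ℝ)
    (hp : ContDiff ℝ (⊤ : ℕ∞) p) (hq : ContDiff ℝ (⊤ : ℕ∞) q) (hφ : ContDiff ℝ (⊤ : ℕ∞) φ)
    (hp' : ∀ u ∈ Ioo a b, deriv p u = Real.cos (φ u))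
    (hq' : ∀ u ∈ Ioo a b, deriv q u = Real.sin (φ u))
    (lam mu : ℝ)
    (h : ∀ u ∈ Ioo a b, lam * p u * Real.sin (φ u) - mu * q u * Real.cos (φ u) = 2)
    (Ω : ℝ → ℝ)
    (hΩ : ∀ u, Ω u = lam * p u * Real.cos (φ u) + mu * q u * Real.sin (φ u)) :
    ∀ u ∈ Ioo a b,
      Ω u * deriv φ u = (mu - lam) * Real.cos (φ u) * Real.sin (φ u) ∧
      deriv Ω u =
        lam * Real.cos (φ u) ^ 2 + mu * Real.sin (φ u) ^ 2 - 2 * deriv φ u := by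
  intro u hu
  have dp : HasDerivAt p (Real.cos (φ u)) u :=
    hp' u hu ▸ (hp.differentiable (by simp) u).hasDerivAt
  have dq : HasDerivAt q (Real.sin (φ u)) u :=
    hq' u hu ▸ (hq.differentiable (by simp) u).hasDerivAt
  have dφ : HasDerivAt φ (deriv φ u) u := (hφ.differentiable (by simp) u).hasDerivAt
  constructor
  · have hd := ((dp.const_mul lam).fun_mul dφ.sin).fun_sub ((dq.const_mul mu).fun_mul dφ.cos)
    have hc : (fun x => lam * p x * Real.sin (φ x) - mu * q x * Real.cos (φ x)) =ᶠ[nhds u]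
        fun _ => (2 : ℝ) :=
      Filter.eventually_of_mem (isOpen_Ioo.mem_nhds hu) h
    have h0 := hd.unique ((hasDerivAt_const u (2 : ℝ)).congr_of_eventuallyEq hc)
    rw [hΩ]
    linear_combination h0
  · have hd := ((dp.const_mul lam).fun_mul dφ.cos).fun_add ((dq.const_mul mu).fun_mul dφ.sin)
    rw [funext hΩ, hd.deriv]
    linear_combination -deriv φ u * h u hu
end
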